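/- Let A be a finite alphabet with |A| ≥ 2, let σ be a permutation of A, and let θ : A* → A* be either the monoid automorphism extending σ or the anti-automorphism extending σ (θ(a_1⋯a_n) = σ(a_n)⋯σ(a_1)). For every regular θ̲-independent code X ⊆ A*, the following are equivalent: (i) X is maximal in the family of θ̲-independent codes; (ii) X is complete; (iii) μ(X) = 1, where μ is the uniform Bernoulli measure. Moreover, every regular θ̲-independent code can be embedded into a code that is maximal in the family of θ̲-independent codes. -/

import Mathlib

open scoped ENNReal

/-- Length of a longest common prefix of `w` and `w'`. -/
noncomputable def lcpLen {A : Type*} (w w' : List A) : ℕ :=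
  sSup {n | ∃ p : List A, p.length = n ∧ p <+: w ∧ p <+: w'}

/-- The prefix distance `d_P(w,w') = |w| + |w'| - 2|w ∧ w'|`. -/
noncomputable def dP {A : Type*} (w w' : List A) : ℕ :=
  w.length + w'.length - 2 * lcpLen w w'

/-- Length of a longest common suffix of `w` and `w'`. -/
noncomputable def lcsLen {A : Type*} (w w' : List A) : ℕ :=
  sSup {n | ∃ s : List A, s.length = n ∧ s <:+ w ∧ s <:+ w'}

/-- The suffix distance `d_S(w,w') = |w| + |w'| - 2|s|`. -/
noncomputable def dS {A : Type*} (w w' : List A) : ℕ :=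
  w.length + w'.length - 2 * lcsLen w w'

/-- Length of a longest common factor of `w` and `w'`. -/
noncomputable def lcfLen {A : Type*} (w w' : List A) : ℕ :=
  sSup {n | ∃ f : List A, f.length = n ∧ f <:+: w ∧ f <:+: w'}

/-- The factor distance `d_F(w,w') = |w| + |w'| - 2|f|`,
`f` a maximum-length common factor. -/
noncomputable def dF {A : Type*} (w w' : List A) : ℕ :=
  w.length + w'.length - 2 * lcfLen w w'

/-- `n`-fold composition of a binary relation. -/
def relPow {α : Type*} (r : α → α → Prop) : ℕ → α → α → Prop
  | 0 => Eq
  | n + 1 => Relation.Comp (relPow r n) r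

/-- `X` is a (variable-length) code: every word of `X*` factorizes uniquely over `X`. -/
def IsCode {A : Type*} (X : Set (List A)) : Prop :=
  ∀ l m : List (List A), (∀ x ∈ l, x ∈ X) → (∀ x ∈ m, x ∈ X) →
    l.flatten = m.flatten → l = m

/-- `X` is complete: every word is a factor of some word of `X*`. -/
def IsCompleteSet {A : Type*} (X : Set (List A)) : Prop :=
  ∀ w : List A, ∃ l : List (List A), (∀ x ∈ l, x ∈ X) ∧ w <:+: l.flatten

/-- `X ⊆ A*` is a regular language: accepted by a finite deterministic automaton. -/
def IsRegularLang {A : Type*} (X : Set (List A)) : Prop :=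
  ∃ (Q : Type) (_ : Fintype Q) (M : DFA A Q), M.accepts = X

/-- The uniform Bernoulli measure `μ(X) = Σ_{x ∈ X} |A|^{-|x|}`. -/
noncomputable def mu (A : Type*) [Fintype A] (X : Set (List A)) : ℝ≥0∞ :=
  ∑' x : X, ((Fintype.card A : ℝ≥0∞))⁻¹ ^ (x : List A).length

section Codes

variable {A : Type*}

/-- The words of `X*`. -/
def starSet (X : Set (List A)) : Set (List A) :=
  {u | ∃ l : List (List A), (∀ x ∈ l, x ∈ X) ∧ l.flatten = u}

/-- No nonempty proper suffix of `y` is a prefix of `y`. -/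
def Unbordered (y : List A) : Prop :=
  ∀ d e : List A, d ++ e = y → e <+: y → d = [] ∨ e = []

theorem IsCode.nil_notMem {X : Set (List A)} (h : IsCode X) : [] ∉ X := by
  intro hn
  have := h [[]] [] (by simpa using hn) (by simp) (by simp)
  simp at this

theorem append_mem_starSet {X : Set (List A)} {x u : List A} (hx : x ∈ X)
    (hu : u ∈ starSet X) : x ++ u ∈ starSet X := by
  obtain ⟨l, hl, rfl⟩ := hu
  exact ⟨x :: l, by simpa using ⟨hx, hl⟩, by simp⟩

theorem mem_starSet_of_mem {X : Set (List A)} {x : List A} (hx : x ∈ X) : x ∈ starSet X :=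
  ⟨[x], by simpa using hx, by simp⟩

/-- The first coding word ending after the left end of an occurrence of `w` ends inside it. -/
theorem exists_suffix_append_mem_starSet {X : Set (List A)} {w : List A}
    (hw : ∀ x ∈ X, ¬ w <:+: x) (t : List A) (l : List (List A)) :
    ∀ a : List A, (∀ x ∈ l, x ∈ X) → a ++ (w ++ t) = l.flatten →
      ∃ p, p <:+ w ∧ p ++ t ∈ starSet X := by
  induction l with
  | nil =>
    intro a _ h
    simp only [List.flatten_nil, List.append_eq_nil_iff] at h
    obtain ⟨-, rfl, rfl⟩ := h
    exact ⟨[], by simp, [], by simp, by simp⟩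
  | cons x l ih =>
    intro a hl h
    rw [List.flatten_cons, List.append_eq_append_iff] at h
    obtain ⟨c, rfl, h⟩ | ⟨c, rfl, h⟩ := h
    · rw [List.append_eq_append_iff] at h
      obtain ⟨d, rfl, h⟩ | ⟨d, rfl, h⟩ := h
      · exact absurd ⟨a, d, by simp⟩ (hw _ (hl _ List.mem_cons_self))
      · exact ⟨d, ⟨c, rfl⟩, l, fun y hy => hl y (by simp [hy]), h⟩
    · exact ih c (fun y hy => hl y (by simp [hy])) h.symm

/-- The last coding word starting before the right end of an occurrence of `w` starts inside it. -/
theorem exists_append_prefix_mem_starSet {X : Set (List A)} {w : List A}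
    (hw : ∀ x ∈ X, ¬ w <:+: x) (b : List A) (l : List (List A)) :
    ∀ t : List A, (∀ x ∈ l, x ∈ X) → t ++ (w ++ b) = l.flatten →
      ∃ s, s <+: w ∧ t ++ s ∈ starSet X := by
  induction l with
  | nil =>
    intro t _ h
    simp only [List.flatten_nil, List.append_eq_nil_iff] at h
    obtain ⟨rfl, rfl, rfl⟩ := h
    exact ⟨[], by simp, [], by simp, by simp⟩
  | cons x l ih =>
    intro t hl h
    rw [List.flatten_cons, List.append_eq_append_iff] at h
    obtain ⟨c, rfl, h⟩ | ⟨c, rfl, h⟩ := h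
    · rw [List.append_eq_append_iff] at h
      obtain ⟨d, rfl, h⟩ | ⟨d, rfl, h⟩ := h
      · exact absurd ⟨t, d, by simp⟩ (hw _ (hl _ List.mem_cons_self))
      · exact ⟨c, ⟨d, rfl⟩, mem_starSet_of_mem (hl _ (by simp))⟩
    · obtain ⟨s, hs, hts⟩ := ih c (fun y hy => hl y (by simp [hy])) h.symm
      refine ⟨s, hs, ?_⟩
      rw [List.append_assoc]
      exact append_mem_starSet (hl _ (by simp)) hts

/-- For a complete set, every word is in `X*` up to adding a suffix of `w` on the left and a
prefix of `w` on the right, as soon as `w` is not a factor of a word of `X`. -/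
theorem IsCompleteSet.exists_append_mem_starSet {X : Set (List A)} (hX : IsCompleteSet X)
    {w : List A} (hw : ∀ x ∈ X, ¬ w <:+: x) (u : List A) :
    ∃ p s, p <:+ w ∧ s <+: w ∧ p ++ u ++ s ∈ starSet X := by
  obtain ⟨l, hl, a, b, h⟩ := hX (w ++ u ++ w)
  obtain ⟨p, hp, l', hl', h'⟩ := exists_suffix_append_mem_starSet hw (u ++ (w ++ b)) l a hl
    (by simpa using h)
  obtain ⟨s, hs, h''⟩ := exists_append_prefix_mem_starSet hw b l' (p ++ u) hl'
    (by simpa using h'.symm)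
  exact ⟨p, s, hp, hs, h''⟩

section Measure

variable [Fintype A]

theorem mu_mono {S T : Set (List A)} (h : S ⊆ T) : mu A S ≤ mu A T :=
  ENNReal.tsum_mono_subtype (fun x : List A => ((Fintype.card A : ℝ≥0∞))⁻¹ ^ x.length) h

theorem mu_univ [Nonempty A] : mu A (Set.univ : Set (List A)) = ⊤ := by
  have hk : (Fintype.card A : ℝ≥0∞) ≠ 0 := by simp
  have hk' : (Fintype.card A : ℝ≥0∞) ≠ ⊤ := by simp
  unfold mu
  rw [tsum_univ (fun x : List A => ((Fintype.card A : ℝ≥0∞))⁻¹ ^ x.length),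
    ← (Equiv.sigmaFiberEquiv (List.length (α := A))).tsum_eq, ENNReal.tsum_sigma']
  have : ∀ n : ℕ, ∑' v : {l : List A // l.length = n},
      ((Fintype.card A : ℝ≥0∞))⁻¹ ^ (v : List A).length = 1 := by
    intro n
    have h1 : ∀ v : {l : List A // l.length = n},
        ((Fintype.card A : ℝ≥0∞))⁻¹ ^ (v : List A).length = (Fintype.card A : ℝ≥0∞)⁻¹ ^ n :=
      fun v => by rw [v.2]
    simp_rw [h1]
    have : Fintype {l : List A // l.length = n} := inferInstanceAs (Fintype (List.Vector A n))
    have hc : Fintype.card {l : List A // l.length = n} = Fintype.card A ^ n := by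
      rw [← card_vector (α := A) n]
      exact Fintype.card_congr (Equiv.refl _)
    rw [tsum_fintype, Finset.sum_const, Finset.card_univ, hc, nsmul_eq_mul, Nat.cast_pow,
      ← mul_pow, ENNReal.mul_inv_cancel hk hk', one_pow]
  simp only [Equiv.sigmaFiberEquiv, Equiv.coe_fn_mk]
  simp_rw [this]
  exact ENNReal.tsum_const_eq_top_of_ne_zero one_ne_zero

theorem mu_image2_append_le (S T : Set (List A)) :
    mu A (Set.image2 (· ++ ·) S T) ≤ mu A S * mu A T := by
  have hs : Function.Surjective (fun q : S × T =>
      (⟨q.1 ++ q.2, q.1, q.1.2, q.2, q.2.2, rfl⟩ : Set.image2 (· ++ ·) S T)) := by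
    rintro ⟨_, x, hx, y, hy, rfl⟩
    exact ⟨⟨⟨x, hx⟩, ⟨y, hy⟩⟩, rfl⟩
  unfold mu
  refine (ENNReal.tsum_le_tsum_comp_of_surjective hs _).trans_eq ?_
  rw [ENNReal.tsum_prod']
  simp only [List.length_append, pow_add]
  simp_rw [ENNReal.tsum_mul_left, ENNReal.tsum_mul_right]

theorem mu_starSet_lt_top {X : Set (List A)} (hX : mu A X < 1) : mu A (starSet X) < ⊤ := by
  let T : ℕ → Set (List A) := fun n =>
    {u | ∃ l : List (List A), l.length = n ∧ (∀ x ∈ l, x ∈ X) ∧ l.flatten = u}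
  have hT : ∀ n, mu A (T n) ≤ mu A X ^ n := by
    intro n
    induction n with
    | zero =>
      have : T 0 ⊆ {[]} := by
        rintro _ ⟨l, hl, -, rfl⟩
        simp_all
      refine (mu_mono this).trans ?_
      unfold mu
      rw [tsum_singleton ([] : List A) (fun x : List A => ((Fintype.card A : ℝ≥0∞))⁻¹ ^ x.length)]
      simp
    | succ n ih =>
      have : T (n + 1) ⊆ Set.image2 (· ++ ·) X (T n) := by
        rintro _ ⟨l, hl, h, rfl⟩
        obtain _ | ⟨x, l⟩ := l
        · simp at hl
        · exact ⟨x, h x (by simp), l.flatten,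
            ⟨l, by simpa using hl, fun y hy => h y (by simp [hy]), rfl⟩, by simp⟩
      calc mu A (T (n + 1)) ≤ mu A X * mu A (T n) :=
            (mu_mono this).trans (mu_image2_append_le _ _)
        _ ≤ mu A X ^ (n + 1) := by rw [pow_succ']; gcongr
  have hU : starSet X ⊆ ⋃ n, T n := by
    rintro _ ⟨l, hl, rfl⟩
    exact Set.mem_iUnion.2 ⟨l.length, l, rfl, hl, rfl⟩
  calc mu A (starSet X) ≤ mu A (⋃ n, T n) := mu_mono hU
    _ ≤ ∑' n, mu A (T n) := ENNReal.tsum_iUnion_le_tsum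
        (fun x : List A => ((Fintype.card A : ℝ≥0∞))⁻¹ ^ x.length) T
    _ ≤ ∑' n, mu A X ^ n := ENNReal.tsum_le_tsum hT
    _ = (1 - mu A X)⁻¹ := ENNReal.tsum_geometric _
    _ < ⊤ := by simpa using hX

theorem mu_preimage_append_lt_top [Nonempty A] {S : Set (List A)} (hS : mu A S < ⊤)
    (p s : List A) : mu A {u | p ++ u ++ s ∈ S} < ⊤ := by
  have hk : (Fintype.card A : ℝ≥0∞) ≠ 0 := by simp
  have hk' : (Fintype.card A : ℝ≥0∞) ≠ ⊤ := by simp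
  set c := p.length + s.length
  have hinj : Function.Injective (fun u : {u | p ++ u ++ s ∈ S} => (⟨p ++ u ++ s, u.2⟩ : S)) := by
    intro u v h
    simpa [Subtype.ext_iff] using h
  have key : mu A {u | p ++ u ++ s ∈ S} ≤ (Fintype.card A : ℝ≥0∞) ^ c * mu A S := by
    unfold mu
    rw [← ENNReal.tsum_mul_left]
    refine le_trans (ENNReal.tsum_le_tsum fun u => ?_) (ENNReal.tsum_comp_le_tsum_of_injective hinj
      (fun x : S => (Fintype.card A : ℝ≥0∞) ^ c *
        (Fintype.card A : ℝ≥0∞)⁻¹ ^ (x : List A).length))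
    have : (p ++ (u : List A) ++ s).length = c + (u : List A).length := by
      simp only [List.length_append, c]; omega
    simp only [this]
    rw [pow_add _ c, ← mul_assoc, ← mul_pow, ENNReal.mul_inv_cancel hk hk', one_pow, one_mul]
  exact key.trans_lt (ENNReal.mul_lt_top (ENNReal.pow_lt_top hk'.lt_top) hS)

theorem IsCompleteSet.one_le_mu [Nonempty A] {X : Set (List A)} (hX : IsCompleteSet X)
    {w : List A} (hw : ∀ x ∈ X, ¬ w <:+: x) : 1 ≤ mu A X := by
  by_contra! hlt
  have hstar := mu_starSet_lt_top hlt
  let ι := {p : List A // p ∈ w.tails} × {s : List A // s ∈ w.inits}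
  let U : ι → Set (List A) := fun q => {u | (q.1 : List A) ++ u ++ q.2 ∈ starSet X}
  have hcov : (Set.univ : Set (List A)) ⊆ ⋃ q, U q := by
    intro u _
    obtain ⟨p, s, hp, hs, h⟩ := hX.exists_append_mem_starSet hw u
    exact Set.mem_iUnion.2 ⟨⟨⟨p, by simpa using hp⟩, ⟨s, by simpa using hs⟩⟩, h⟩
  have hfin : mu A (⋃ q, U q) < ⊤ := by
    classical
    refine lt_of_le_of_lt (ENNReal.tsum_iUnion_le
      (fun x : List A => ((Fintype.card A : ℝ≥0∞))⁻¹ ^ x.length) U) ?_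
    exact ENNReal.sum_lt_top.2 fun q _ => mu_preimage_append_lt_top hstar _ _
  exact absurd (mu_univ (A := A)) ((mu_mono hcov).trans_lt hfin).ne

theorem IsCode.mu_le_one [Nonempty A] {X : Set (List A)} (hX : IsCode X) : mu A X ≤ 1 := by
  unfold mu
  rw [ENNReal.tsum_eq_iSup_sum]
  refine iSup_le fun s => ?_
  classical
  have hud : InformationTheory.UniquelyDecodable
      ((s.map (Function.Embedding.subtype (· ∈ X)) : Finset (List A)) : Set (List A)) := by
    intro l m hl hm h
    refine hX l m (fun x hx => ?_) (fun x hx => ?_) h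
    · have := hl x hx
      simp at this
      exact this.1
    · have := hm x hx
      simp at this
      exact this.1
  have h := InformationTheory.kraft_mcmillan_inequality hud
  rw [Finset.sum_map] at h
  have h2 := ENNReal.ofReal_le_ofReal h
  rw [ENNReal.ofReal_one, ENNReal.ofReal_sum_of_nonneg (fun _ _ => by positivity)] at h2
  refine le_trans (le_of_eq (Finset.sum_congr rfl fun x _ => ?_)) h2
  rw [ENNReal.ofReal_pow (by positivity), one_div,
    ENNReal.ofReal_inv_of_pos (by exact_mod_cast Fintype.card_pos), ENNReal.ofReal_natCast]
  rfl

/-- A code of measure `1` is contained in no other code. -/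
theorem IsCode.eq_of_subset_of_mu_eq_one [Nonempty A] {X Y : Set (List A)} (hY : IsCode Y)
    (hXY : X ⊆ Y) (hX : mu A X = 1) : Y = X := by
  refine Set.Subset.antisymm (fun y hy => ?_) hXY
  by_contra hyX
  have h := (mu_mono (Set.insert_subset hy hXY)).trans hY.mu_le_one
  have hk' : (Fintype.card A : ℝ≥0∞) ≠ ⊤ := by simp
  have hd : Disjoint ({y} : Set (List A)) X := by simpa using hyX
  unfold mu at h hX
  rw [Set.insert_eq, ENNReal.summable.tsum_union_disjoint
    (f := fun x : List A => ((Fintype.card A : ℝ≥0∞))⁻¹ ^ x.length) hd ENNReal.summable, hX,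
    tsum_singleton y (fun x : List A => ((Fintype.card A : ℝ≥0∞))⁻¹ ^ x.length)] at h
  have h0 : (Fintype.card A : ℝ≥0∞)⁻¹ ^ y.length ≠ 0 := by simp
  have : (1 : ℝ≥0∞) < (Fintype.card A : ℝ≥0∞)⁻¹ ^ y.length + 1 := by
    rw [add_comm]
    exact ENNReal.lt_add_right ENNReal.one_ne_top h0
  exact absurd h this.not_ge

end Measure

/-- A self-map of a finite type which is injective on its range equals one of its proper
iterates. -/
theorem exists_iterate_eq_self {Q : Type*} [Finite Q] {f : Q → Q}
    (hf : Set.InjOn f (Set.range f)) : ∃ m, f^[m + 2] = f := by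
  have descend : ∀ i m : ℕ, f^[i + 1] = f^[i + 1 + m] → f = f^[m + 1] := by
    intro i m
    induction i with
    | zero => intro h; simpa [add_comm] using h
    | succ i ih =>
      intro h
      refine ih (funext fun q => hf ⟨f^[i] q, ?_⟩ ⟨f^[i + m] q, ?_⟩ ?_)
      · rw [Function.iterate_succ_apply']
      · rw [show i + 1 + m = (i + m) + 1 by omega, Function.iterate_succ_apply']
      · have := congrFun h q
        rw [show i + 1 + 1 + m = (i + 1 + m) + 1 by omega] at this
        simpa only [Function.iterate_succ_apply'] using this
  obtain ⟨i, j, hij, h⟩ := Finite.exists_ne_map_eq_of_infinite (fun n : ℕ => f^[n + 1])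
  wlog hlt : i < j generalizing i j
  · exact this j i hij.symm h.symm (by omega)
  obtain ⟨m, rfl⟩ := Nat.exists_eq_add_of_lt hlt
  refine ⟨m, (descend i (m + 1) ?_).symm⟩
  rw [show i + 1 + (m + 1) = i + m + 1 + 1 by omega]
  exact h

/-- A regular code is thin: some word is not a factor of its elements. -/
theorem IsRegularLang.exists_not_infix {X : Set (List A)} (hreg : IsRegularLang X)
    (hcode : IsCode X) : ∃ v, ∀ x ∈ X, ¬ v <:+: x := by
  by_contra! hdense
  obtain ⟨Q, _, M, rfl⟩ := hreg
  let F : List A → Q → Q := fun w q => M.evalFrom q w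
  have Fapp : ∀ u v, F (u ++ v) = F v ∘ F u := fun u v =>
    funext fun q => M.evalFrom_of_append q u v
  let rk : List A → ℕ := fun w => (Set.range (F w)).ncard
  have rk_le : ∀ u w v, rk (u ++ w ++ v) ≤ rk w := by
    intro u w v
    simp only [rk, Fapp]
    rw [Set.range_comp]
    refine (Set.ncard_image_le (Set.toFinite _)).trans ?_
    exact Set.ncard_le_ncard (Set.range_comp_subset_range _ _) (Set.toFinite _)
  obtain ⟨_, ⟨w, rfl⟩, hmin⟩ := wellFounded_lt.has_min (Set.range rk) ⟨_, [], rfl⟩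
  obtain ⟨x, hx, u, v, rfl⟩ := hdense w
  set x := u ++ w ++ v
  have hxmin : rk x ≤ rk (x ++ x) :=
    (rk_le u w v).trans (not_lt.1 (hmin _ ⟨_, rfl⟩))
  have hxmin' : rk (x ++ x) ≤ rk x := by simpa using rk_le x x []
  have hinj : Set.InjOn (F x) (Set.range (F x)) := by
    apply Set.injOn_of_ncard_image_eq _ (Set.toFinite _)
    rw [← Set.range_comp, ← Fapp]
    exact le_antisymm hxmin' hxmin
  obtain ⟨m, hm⟩ := exists_iterate_eq_self hinj
  have hpow : ∀ n, F (List.replicate n x).flatten = (F x)^[n] := by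
    intro n
    induction n with
    | zero => rfl
    | succ n ih => rw [List.replicate_succ, List.flatten_cons, Fapp, ih, Function.iterate_succ]
  have hmem : (List.replicate (m + 2) x).flatten ∈ M.accepts := by
    have h := congrFun ((hpow (m + 2)).trans hm) M.start
    change F _ M.start ∈ M.accept
    rw [h]
    exact hx
  have := congrArg List.length (hcode [(List.replicate (m + 2) x).flatten]
    (List.replicate (m + 2) x) (fun y hy => by rw [List.mem_singleton.1 hy]; exact hmem)
    (fun y hy => by rw [List.eq_of_mem_replicate hy]; exact hx) (by simp))
  simp at this

theorem unbordered_append_replicate {a b : A} (hab : a ≠ b) (z : List A) :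
    Unbordered (a :: z ++ a :: List.replicate (z.length + 1) b) := by
  intro d e hde hpre
  by_contra! hne
  set y := a :: z ++ a :: List.replicate (z.length + 1) b with hy
  have hlen : y.length = 2 * z.length + 3 := by simp [hy]; omega
  have hlen' : d.length + e.length = y.length := by rw [← hde]; simp
  have hd : 0 < d.length := List.length_pos_of_ne_nil hne.1
  have he : 0 < e.length := List.length_pos_of_ne_nil hne.2
  have hper : ∀ j, j < e.length → y[j + d.length]? = y[j]? := by
    intro j hj
    obtain ⟨f, hf⟩ := hpre
    have h1 : y[j]? = e[j]? := by rw [← hf, List.getElem?_append_left hj]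
    rw [h1, ← hde, List.getElem?_append_right (by omega)]
    simp
  have h0 : y[0]? = some a := by simp [hy]
  have hmid : y[z.length + 1]? = some a := by
    rw [hy, List.getElem?_append_right (by simp)]; simp
  have hb : ∀ j, z.length + 1 < j → j < 2 * z.length + 3 → y[j]? = some b := by
    intro j h1 h2
    obtain ⟨i, rfl⟩ := Nat.exists_eq_add_of_lt h1
    rw [hy, List.getElem?_append_right (by simp; omega)]
    have : z.length + 1 + i + 1 - (a :: z).length = i + 1 := by simp; omega
    rw [this, List.getElem?_cons_succ, List.getElem?_replicate_of_lt (by omega)]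
  by_cases hk : d.length ≤ z.length + 1
  · have := hper (z.length + 1) (by omega)
    rw [hmid, hb _ (by omega) (by omega)] at this
    exact hab (Option.some.inj this).symm
  · have := hper 0 he
    rw [h0, hb _ (by omega) (by omega)] at this
    exact hab (Option.some.inj this).symm

/-- An occurrence of an unbordered word `y` in `y ++ r`, preceded by a word `d` which does not have
`y` as a factor, is the initial one. -/
theorem Unbordered.eq_nil_of_append_eq {y : List A} (hy : Unbordered y) {d r s : List A}
    (hd : ¬ y <:+: d) (h : y ++ r = d ++ (y ++ s)) : d = [] := by
  rw [List.append_eq_append_iff] at h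
  obtain ⟨e, rfl, -⟩ | ⟨e, he, h⟩ := h
  · exact absurd ⟨[], e, by simp⟩ hd
  · have hpre : e <+: y := by
      have h1 : e <+: y ++ s := ⟨r, h.symm⟩
      exact List.prefix_of_prefix_length_le h1 ⟨s, rfl⟩ (by rw [he]; simp)
    obtain h0 | rfl := hy d e he.symm hpre
    · exact h0
    · exact absurd ⟨[], [], by simp [he]⟩ hd

theorem exists_split_at_mem {X : Set (List A)} {y : List A} (l : List (List A))
    (hl : ∀ x ∈ l, x ∈ insert y X) :
    (∀ x ∈ l, x ∈ X) ∨ ∃ l₀ l₁, l = l₀ ++ y :: l₁ ∧ (∀ x ∈ l₀, x ∈ X) := by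
  induction l with
  | nil => simp
  | cons x l ih =>
    obtain rfl | hx := hl x (by simp)
    · exact Or.inr ⟨[], l, by simp, by simp⟩
    · obtain h | ⟨l₀, l₁, rfl, h⟩ := ih fun z hz => hl z (by simp [hz])
      · exact Or.inl (by simpa using ⟨hx, h⟩)
      · exact Or.inr ⟨x :: l₀, l₁, by simp, by simpa using ⟨hx, h⟩⟩

/-- Adding to a code `X` an unbordered word which is not a factor of `X*` gives a code. -/
theorem IsCode.insert_unbordered {X : Set (List A)} (hX : IsCode X) {y : List A}
    (hy : Unbordered y) (hyX : ∀ l : List (List A), (∀ x ∈ l, x ∈ X) → ¬ y <:+: l.flatten) :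
    IsCode (insert y X) := by
  have aux : ∀ (l₀ m₀ : List (List A)) (r s : List A), (∀ x ∈ l₀, x ∈ X) → (∀ x ∈ m₀, x ∈ X) →
      l₀.flatten ++ (y ++ r) = m₀.flatten ++ (y ++ s) → l₀ = m₀ := by
    intro l₀ m₀ r s hl hm h
    apply hX _ _ hl hm
    rw [List.append_eq_append_iff] at h
    obtain ⟨d, hd, h⟩ | ⟨d, hd, h⟩ := h
    · have := hy.eq_nil_of_append_eq (fun hi => hyX m₀ hm (by
        rw [hd]; exact hi.trans ⟨l₀.flatten, [], by simp⟩)) h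
      simpa [this] using hd.symm
    · have := hy.eq_nil_of_append_eq (fun hi => hyX l₀ hl (by
        rw [hd]; exact hi.trans ⟨m₀.flatten, [], by simp⟩)) h
      simpa [this] using hd
  have step : ∀ n (l m : List (List A)), l.length ≤ n → (∀ x ∈ l, x ∈ insert y X) →
      (∀ x ∈ m, x ∈ insert y X) → l.flatten = m.flatten → l = m := by
    intro n
    induction n with
    | zero =>
      intro l m hn hl hm h
      obtain rfl : l = [] := by simpa using hn
      obtain hm' | ⟨m₀, m₁, rfl, -⟩ := exists_split_at_mem m hm
      · exact hX _ _ (by simp) hm' h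
      · refine absurd ?_ (hyX [] (by simp))
        rw [h]
        exact ⟨m₀.flatten, m₁.flatten, by simp⟩
    | succ n ih =>
      intro l m hn hl hm h
      obtain hl' | ⟨l₀, l₁, rfl, hl₀⟩ := exists_split_at_mem l hl <;>
        obtain hm' | ⟨m₀, m₁, rfl, hm₀⟩ := exists_split_at_mem m hm
      · exact hX _ _ hl' hm' h
      · refine absurd ?_ (hyX _ hl')
        rw [h]
        exact ⟨m₀.flatten, m₁.flatten, by simp⟩
      · refine absurd ?_ (hyX _ hm')
        rw [← h]
        exact ⟨l₀.flatten, l₁.flatten, by simp⟩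
      · simp only [List.flatten_append, List.flatten_cons] at h
        obtain rfl := aux l₀ m₀ _ _ hl₀ hm₀ h
        simp only [List.append_cancel_left_eq] at h
        rw [ih l₁ m₁ (by simp at hn; omega) (fun x hx => hl x (by simp [hx]))
          (fun x hx => hm x (by simp [hx])) h]
  exact fun l m => step l.length l m le_rfl

/-- The inverse of the (anti-)automorphism extending a permutation; all that is used is that both
maps preserve the factor order. -/
theorem exists_infix_monotone_inverse (σ : Equiv.Perm A) (θ : List A → List A)
    (hθ : (∀ w : List A, θ w = w.map σ) ∨ (∀ w : List A, θ w = (w.map σ).reverse)) :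
    ∃ η : List A → List A, (∀ w, θ (η w) = w) ∧ (∀ w, η (θ w) = w) ∧
      (∀ u w, u <:+: w → θ u <:+: θ w) ∧ (∀ u w, u <:+: w → η u <:+: η w) := by
  obtain h | h := hθ
  · refine ⟨fun w => w.map σ.symm, fun w => ?_, fun w => ?_, fun u w huw => ?_,
      fun u w huw => huw.map _⟩
    · simp [h]
    · simp [h]
    · rw [h, h]
      exact huw.map _
  · refine ⟨fun w => (w.map σ.symm).reverse, fun w => ?_, fun w => ?_, fun u w huw => ?_,
      fun u w huw => (huw.map _).reverse⟩
    · simp [h]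
    · simp [h]
    · rw [h, h]
      exact (huw.map _).reverse

/-- A code `X` which is thin and maximal among `θ`-independent codes is complete. -/
theorem isCompleteSet_of_maximal [Nontrivial A] {θ η : List A → List A}
    (hθη : ∀ w, θ (η w) = w) (hηθ : ∀ w, η (θ w) = w)
    (hθ : ∀ u w, u <:+: w → θ u <:+: θ w) (hη : ∀ u w, u <:+: w → η u <:+: η w)
    {X : Set (List A)} {v : List A} (hv : ∀ x ∈ X, ¬ v <:+: x) (hcode : IsCode X)
    (hind : ¬ ∃ x ∈ X, ∃ y ∈ X, x ≠ y ∧ y = θ x)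
    (hmax : ∀ Y : Set (List A), IsCode Y → (¬ ∃ x ∈ Y, ∃ y ∈ Y, x ≠ y ∧ y = θ x) →
        X ⊆ Y → Y = X) : IsCompleteSet X := by
  unfold IsCompleteSet
  by_contra! hw
  obtain ⟨w, hw⟩ := hw
  obtain ⟨a, b, hab⟩ := exists_pair_ne A
  set z := w ++ θ v ++ η v with hz
  set y := a :: z ++ a :: List.replicate (z.length + 1) b with hy
  have hzy : z <:+: y := ⟨[a], a :: List.replicate (z.length + 1) b, by simp [hy]⟩
  have hwy : w <:+: y := List.IsInfix.trans ⟨[], θ v ++ η v, by simp [hz]⟩ hzy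
  have hθv : θ v <:+: y := List.IsInfix.trans ⟨w, η v, rfl⟩ hzy
  have hηv : η v <:+: y := List.IsInfix.trans ⟨w ++ θ v, [], by simp [hz]⟩ hzy
  have hyX : ∀ l : List (List A), (∀ x ∈ l, x ∈ X) → ¬ y <:+: l.flatten :=
    fun l hl h => hw l hl (hwy.trans h)
  have hcode' := hcode.insert_unbordered (unbordered_append_replicate hab z) hyX
  have hind' : ¬ ∃ x ∈ insert y X, ∃ y' ∈ insert y X, x ≠ y' ∧ y' = θ x := by
    rintro ⟨x, rfl | hx, x', rfl | hx', hne, he⟩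
    · exact hne rfl
    · refine hv x' hx' ?_
      have := hθ _ _ hηv
      rwa [hθη, ← he] at this
    · refine hv x hx ?_
      have := hη _ _ hθv
      rwa [hηθ, he, hηθ] at this
    · exact hind ⟨x, hx, x', hx', hne, he⟩
  have hmem : y ∈ X := by
    rw [← hmax _ hcode' hind' (Set.subset_insert y X)]
    exact Set.mem_insert y X
  exact hyX [y] (by simpa using hmem) (by simp)

theorem exists_maximal_independent_code {θ : List A → List A} {X : Set (List A)}
    (hcode : IsCode X) (hind : ¬ ∃ x ∈ X, ∃ y ∈ X, x ≠ y ∧ y = θ x) :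
    ∃ Y : Set (List A), X ⊆ Y ∧ IsCode Y ∧
      (¬ ∃ x ∈ Y, ∃ y ∈ Y, x ≠ y ∧ y = θ x) ∧
      (∀ Z : Set (List A), IsCode Z →
        (¬ ∃ x ∈ Z, ∃ y ∈ Z, x ≠ y ∧ y = θ x) → Y ⊆ Z → Z = Y) := by
  obtain ⟨Y, hXY, hY⟩ := zorn_subset_nonempty
    {Y : Set (List A) | IsCode Y ∧ ¬ ∃ x ∈ Y, ∃ y ∈ Y, x ≠ y ∧ y = θ x} (fun c hc hch hne => by
      have hfin : ∀ l : List (List A), (∀ x ∈ l, x ∈ ⋃₀ c) → ∃ S ∈ c, ∀ x ∈ l, x ∈ S := by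
        intro l
        induction l with
        | nil => exact fun _ => ⟨hne.some, hne.some_mem, by simp⟩
        | cons x l ih =>
          intro hl
          obtain ⟨S, hS, h⟩ := ih fun z hz => hl z (by simp [hz])
          obtain ⟨T, hT, hx⟩ := hl x (by simp)
          obtain hST | hTS := hch.total hS hT
          · exact ⟨T, hT, by simpa using ⟨hx, fun z hz => hST (h z hz)⟩⟩
          · exact ⟨S, hS, by simpa using ⟨hTS hx, h⟩⟩
      refine ⟨⋃₀ c, ⟨fun l m hl hm h => ?_, ?_⟩, fun S hS => Set.subset_sUnion_of_mem hS⟩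
      · obtain ⟨S, hS, hS'⟩ := hfin (l ++ m) fun x hx =>
          (List.mem_append.1 hx).elim (hl x) (hm x)
        exact (hc hS).1 l m (fun x hx => hS' x (by simp [hx])) (fun x hx => hS' x (by simp [hx])) h
      · rintro ⟨x, hx, y, hy, hxy⟩
        obtain ⟨S, hS, hS'⟩ := hfin [x, y] (by simpa using ⟨hx, hy⟩)
        exact (hc hS).2 ⟨x, hS' x (by simp), y, hS' y (by simp), hxy⟩) X ⟨hcode, hind⟩
  exact ⟨Y, hXY, hY.prop.1, hY.prop.2, fun Z hZ hZ' hYZ => (hY.eq_of_subset ⟨hZ, hZ'⟩ hYZ).symm⟩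

end Codes

/-- for `θ` the (anti-)automorphism of `A*` extending a permutation
`σ` of `A` and a regular `θ̲`-independent code `X`: maximality among
`θ̲`-independent codes, completeness, and `μ(X) = 1` are pairwise equivalent;
moreover `X` embeds in a maximal `θ̲`-independent code. -/
theorem stmt_19 {A : Type*} [Fintype A] (hA : 2 ≤ Fintype.card A)
    (σ : Equiv.Perm A) (θ : List A → List A)
    (hθ : (∀ w : List A, θ w = w.map σ) ∨ (∀ w : List A, θ w = (w.map σ).reverse))
    (X : Set (List A)) (hreg : IsRegularLang X) (hcode : IsCode X)
    (hind : ¬ ∃ x ∈ X, ∃ y ∈ X, x ≠ y ∧ y = θ x) :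
    (((∀ Y : Set (List A), IsCode Y → (¬ ∃ x ∈ Y, ∃ y ∈ Y, x ≠ y ∧ y = θ x) →
        X ⊆ Y → Y = X) ↔ IsCompleteSet X) ∧
      (IsCompleteSet X ↔ mu A X = 1)) ∧
    (∃ Y : Set (List A), X ⊆ Y ∧ IsCode Y ∧
      (¬ ∃ x ∈ Y, ∃ y ∈ Y, x ≠ y ∧ y = θ x) ∧
      (∀ Z : Set (List A), IsCode Z →
        (¬ ∃ x ∈ Z, ∃ y ∈ Z, x ≠ y ∧ y = θ x) → Y ⊆ Z → Z = Y)) := by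
  have : Nontrivial A := Fintype.one_lt_card_iff_nontrivial.1 hA
  obtain ⟨v, hv⟩ := hreg.exists_not_infix hcode
  obtain ⟨η, hθη, hηθ, hθm, hηm⟩ := exists_infix_monotone_inverse σ θ hθ
  have h12 := isCompleteSet_of_maximal hθη hηθ hθm hηm hv hcode hind
  have h23 : IsCompleteSet X → mu A X = 1 := fun h =>
    le_antisymm hcode.mu_le_one (h.one_le_mu hv)
  have h31 : mu A X = 1 → ∀ Y : Set (List A), IsCode Y →
      (¬ ∃ x ∈ Y, ∃ y ∈ Y, x ≠ y ∧ y = θ x) → X ⊆ Y → Y = X := fun h Y hY _ hXY =>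
    hY.eq_of_subset_of_mu_eq_one hXY h
  exact ⟨⟨⟨h12, fun h => h31 (h23 h)⟩, h23, fun h => h12 (h31 h)⟩,
    exists_maximal_independent_code hcode hind⟩
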